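/- arXiv:1508.06235 — 2 statements merged into one kernel-verified Lean document; each statement's English description precedes it below -/
import Mathlib

section
/- Let x₁, …, xₙ ∈ ℝ^p (n ≥ 1) be points, φ : ℝ^p → ℝ differentiable, μ : Fin K → ℝ^p fixed cluster centers, ξ₁, ξ₂ ≥ 0 and λ ∈ ℝ. Let e : Fin n → Fin n → ℝ be symmetric with e i i = 0 and values in {−1, 0, 1}. For an assignment z : Fin n → Fin K define the objective J(z) = Σᵢ D_φ(xᵢ, μ_{z i}) − ξ₁ · |{(i,j) : i < j, z i = z j, e i j = 1}| + ξ₂ · |{(i,j) : i < j, z i = z j, e i j = −1}| + λ·K. Fix i and b ∈ Fin K, and for each k let f_k = |{j ≠ i : z j = k and e i j = 1}| and s_k = |{j ≠ i : z j = k and e i j = −1}|. If D_φ(xᵢ, μ_b) − ξ₁·f_b + ξ₂·s_b ≤ D_φ(xᵢ, μ_{z i}) − ξ₁·f_{z i} + ξ₂·s_{z i}, then J(z') ≤ J(z), where z' equals z except that z' i = b. -/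
open scoped RealInnerProductSpace

/-- Bregman divergence `D_φ(x, y) = φ(x) − φ(y) − ⟨x − y, ∇φ(y)⟩`. -/
noncomputable def bregman {p : ℕ} (φ : EuclideanSpace ℝ (Fin p) → ℝ)
    (x y : EuclideanSpace ℝ (Fin p)) : ℝ :=
  φ x - φ y - ⟪x - y, gradient φ y⟫

/-- The pairs of a symmetric relation split into those meeting `i`, counted by the neighbours
of `i`, and those avoiding `i`. -/
theorem card_lt_pairs_eq_card_neighbors_add {ι : Type*} [Finite ι] [LinearOrder ι]
    (R : ι → ι → Prop) (hR : ∀ j k, R j k → R k j) (i : ι) :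
    Nat.card {pr : ι × ι // pr.1 < pr.2 ∧ R pr.1 pr.2} =
      Nat.card {j : ι // j ≠ i ∧ R i j} +
        Nat.card {pr : ι × ι // pr.1 < pr.2 ∧ pr.1 ≠ i ∧ pr.2 ≠ i ∧ R pr.1 pr.2} := by
  classical
  have := Fintype.ofFinite ι
  simp only [Nat.card_eq_fintype_card, Fintype.card_subtype]
  rw [← Finset.card_filter_add_card_filter_not (fun pr : ι × ι => pr.1 = i ∨ pr.2 = i)]
  congr 1
  · refine Finset.card_bij' (fun pr _ => if pr.1 = i then pr.2 else pr.1)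
      (fun j _ => if i < j then (i, j) else (j, i)) ?_ ?_ ?_ ?_ <;>
    simp only [Finset.mem_filter, Finset.mem_univ, true_and] <;> grind
  · congr 1
    ext pr
    simp only [Finset.mem_filter, Finset.mem_univ, true_and]
    tauto

/-- The number of co-clustered pairs with label `v`, after moving `i` to cluster `b`, plus the
number of `v`-neighbours of `i` in its old cluster, is the old number of such pairs plus the
number of `v`-neighbours of `i` in cluster `b`. -/
theorem card_coclustered_update_add {ι κ α : Type*} [Finite ι] [LinearOrder ι]
    (e : ι → ι → α) (hsym : ∀ i j, e i j = e j i) (z : ι → κ) (i : ι) (b : κ) (v : α) :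
    Nat.card {pr : ι × ι // pr.1 < pr.2 ∧
        Function.update z i b pr.1 = Function.update z i b pr.2 ∧ e pr.1 pr.2 = v} +
      Nat.card {j : ι // j ≠ i ∧ z j = z i ∧ e i j = v} =
    Nat.card {pr : ι × ι // pr.1 < pr.2 ∧ z pr.1 = z pr.2 ∧ e pr.1 pr.2 = v} +
      Nat.card {j : ι // j ≠ i ∧ z j = b ∧ e i j = v} := by
  have split (w : ι → κ) := card_lt_pairs_eq_card_neighbors_add
    (fun j k => w j = w k ∧ e j k = v) (fun j k h => ⟨h.1.symm, hsym j k ▸ h.2⟩) i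
  rw [split (Function.update z i b), split z]
  have new_neighbors :
      Nat.card {j : ι // j ≠ i ∧ Function.update z i b i = Function.update z i b j ∧ e i j = v} =
        Nat.card {j : ι // j ≠ i ∧ z j = b ∧ e i j = v} :=
    Nat.card_congr (Equiv.subtypeEquivRight fun j => by grind)
  have old_neighbors :
      Nat.card {j : ι // j ≠ i ∧ z i = z j ∧ e i j = v} =
        Nat.card {j : ι // j ≠ i ∧ z j = z i ∧ e i j = v} :=
    Nat.card_congr (Equiv.subtypeEquivRight fun j => by rw [eq_comm (a := z i)])
  have avoiding :
      Nat.card {pr : ι × ι // pr.1 < pr.2 ∧ pr.1 ≠ i ∧ pr.2 ≠ i ∧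
          Function.update z i b pr.1 = Function.update z i b pr.2 ∧ e pr.1 pr.2 = v} =
        Nat.card {pr : ι × ι // pr.1 < pr.2 ∧ pr.1 ≠ i ∧ pr.2 ≠ i ∧
          z pr.1 = z pr.2 ∧ e pr.1 pr.2 = v} :=
    Nat.card_congr (Equiv.subtypeEquivRight fun pr => by grind)
  rw [new_neighbors, old_neighbors, avoiding]
  ring

/-- Point-reassignment step of RDP-means: if moving point `i` to cluster `b` does not
increase its augmented distance `D_φ(xᵢ, μ_k) − ξ₁ f_k + ξ₂ s_k`, then the constrained
clustering objective does not increase. -/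
theorem rdpMeans_reassign_decreases_objective {p n K : ℕ} (hn : 1 ≤ n)
    (x : Fin n → EuclideanSpace ℝ (Fin p))
    (φ : EuclideanSpace ℝ (Fin p) → ℝ) (hφ : Differentiable ℝ φ)
    (μ : Fin K → EuclideanSpace ℝ (Fin p))
    (ξ₁ ξ₂ : ℝ) (hξ₁ : 0 ≤ ξ₁) (hξ₂ : 0 ≤ ξ₂) (lam : ℝ)
    (e : Fin n → Fin n → ℝ)
    (hsym : ∀ i j, e i j = e j i) (hdiag : ∀ i, e i i = 0)
    (hvals : ∀ i j, e i j = -1 ∨ e i j = 0 ∨ e i j = 1)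
    (J : (Fin n → Fin K) → ℝ)
    (hJ : ∀ z : Fin n → Fin K,
      J z = (∑ i, bregman φ (x i) (μ (z i)))
        - ξ₁ * (Nat.card {pr : Fin n × Fin n //
            pr.1 < pr.2 ∧ z pr.1 = z pr.2 ∧ e pr.1 pr.2 = 1} : ℝ)
        + ξ₂ * (Nat.card {pr : Fin n × Fin n //
            pr.1 < pr.2 ∧ z pr.1 = z pr.2 ∧ e pr.1 pr.2 = -1} : ℝ)
        + lam * K)
    (z : Fin n → Fin K) (i : Fin n) (b : Fin K)
    (f s : Fin K → ℝ)
    (hf : ∀ k, f k = (Nat.card {j : Fin n // j ≠ i ∧ z j = k ∧ e i j = 1} : ℝ))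
    (hs : ∀ k, s k = (Nat.card {j : Fin n // j ≠ i ∧ z j = k ∧ e i j = -1} : ℝ))
    (hle : bregman φ (x i) (μ b) - ξ₁ * f b + ξ₂ * s b ≤
        bregman φ (x i) (μ (z i)) - ξ₁ * f (z i) + ξ₂ * s (z i)) :
    J (Function.update z i b) ≤ J z := by
  have friends := congrArg (Nat.cast : ℕ → ℝ) (card_coclustered_update_add e hsym z i b 1)
  have strangers := congrArg (Nat.cast : ℕ → ℝ) (card_coclustered_update_add e hsym z i b (-1))
  push_cast at friends strangers
  rw [← hf, ← hf] at friends
  rw [← hs, ← hs] at strangers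
  have dist : (∑ j, bregman φ (x j) (μ (Function.update z i b j))) + bregman φ (x i) (μ (z i)) =
      (∑ j, bregman φ (x j) (μ (z j))) + bregman φ (x i) (μ b) := by
    rw [← Finset.add_sum_erase _ _ (Finset.mem_univ i),
      ← Finset.add_sum_erase _ (fun j => bregman φ (x j) (μ (z j))) (Finset.mem_univ i),
      Finset.sum_congr rfl fun j hj => by
        rw [Function.update_of_ne (Finset.ne_of_mem_erase hj)], Function.update_self]
    ring
  rw [hJ, hJ]
  linear_combination hle + dist - ξ₁ * friends + ξ₂ * strangers
end

section
/- Let x₁, …, xₙ ∈ ℝ^p (n ≥ 1), φ : ℝ^p → ℝ differentiable with ∇φ defined everywhere, ξ₁, ξ₂ ≥ 0 and λ ∈ ℝ. Let e : Fin n → Fin n → ℝ be symmetric with e i i = 0 and values in {−1, 0, 1}. For an assignment z : Fin n → ℕ and centers μ : ℕ → ℝ^p define J(z, μ) = Σᵢ D_φ(xᵢ, μ_{z i}) − ξ₁ · |{(i,j) : i < j, z i = z j, e i j = 1}| + ξ₂ · |{(i,j) : i < j, z i = z j, e i j = −1}| + λ · |range of z|. Fix i, and for each label k let f_k = |{j ≠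 i : z j = k and e i j = 1}| and s_k = |{j ≠ i : z j = k and e i j = −1}|. Suppose D_φ(xᵢ, μ_k) − ξ₁·f_k + ξ₂·s_k > λ for every k in the range of z, that some j ≠ i has z j = z i, and let ℓ be a label not in the range of z. Then J(z', μ') < J(z, μ), where z' equals z except z' i = ℓ, and μ' equals μ except μ' ℓ = xᵢ. -/
open scoped RealInnerProductSpace

@[simp]
theorem bregman_self {p : ℕ} (φ : EuclideanSpace ℝ (Fin p) → ℝ) (x : EuclideanSpace ℝ (Fin p)) :
    bregman φ x x = 0 := by
  simp [bregman]

/-- Moving `i` to an unused label splits off exactly the monochromatic related pairs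
containing `i`. -/
theorem card_monochromatic_pairs_eq_update_add {ι κ : Type*} [LinearOrder ι] [Finite ι]
    {r : ι → ι → Prop} (hr : ∀ a b, r a b → r b a) (z : ι → κ) (i : ι) {l : κ}
    (hl : l ∉ Set.range z) :
    Nat.card {pr : ι × ι // pr.1 < pr.2 ∧ z pr.1 = z pr.2 ∧ r pr.1 pr.2} =
      Nat.card {pr : ι × ι // pr.1 < pr.2 ∧
        Function.update z i l pr.1 = Function.update z i l pr.2 ∧ r pr.1 pr.2} +
      Nat.card {j : ι // j ≠ i ∧ z j = z i ∧ r i j} := by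
  have hne : ∀ a, z a ≠ l := fun a h => hl ⟨a, h⟩
  set A : Set (ι × ι) := {pr | pr.1 < pr.2 ∧ z pr.1 = z pr.2 ∧ r pr.1 pr.2}
  set B : Set (ι × ι) := {pr | pr.1 < pr.2 ∧
    Function.update z i l pr.1 = Function.update z i l pr.2 ∧ r pr.1 pr.2}
  set C : Set ι := {j | j ≠ i ∧ z j = z i ∧ r i j}
  have mem_B (a b : ι) : (a, b) ∈ B ↔ (a, b) ∈ A ∧ a ≠ i ∧ b ≠ i := by
    simp only [A, B, Set.mem_ofPred_eq, Function.update_apply]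
    grind
  let g : ι → ι × ι := fun j => (min i j, max i j)
  have g_inj : Set.InjOn g C := by
    intro a _ b _ h
    simp only [g, Prod.mk.injEq] at h
    grind
  have hdisj : Disjoint B (g '' C) := by
    rw [Set.disjoint_right]
    rintro _ ⟨j, -, rfl⟩ h
    have := (mem_B _ _).1 h
    grind
  have hA : A = B ∪ g '' C := by
    ext ⟨a, b⟩
    simp only [Set.mem_union, mem_B, Set.mem_image]
    simp only [A, C, g, Set.mem_ofPred_eq, Prod.mk.injEq]
    constructor
    · rintro ⟨hab, hz, h⟩
      by_cases ha : a = i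
      · exact Or.inr ⟨b, by grind⟩
      by_cases hb : b = i
      · exact Or.inr ⟨a, by grind⟩
      exact Or.inl ⟨⟨hab, hz, h⟩, ha, hb⟩
    · rintro (h | ⟨j, ⟨hj, hz, h⟩, rfl, rfl⟩)
      · exact h.1
      · have := hr _ _ h
        rcases lt_or_gt_of_ne hj with hlt | hlt
        · simp [min_eq_right hlt.le, max_eq_left hlt.le, *]
        · simp [min_eq_left hlt.le, max_eq_right hlt.le, *]
  change A.ncard = B.ncard + C.ncard
  rw [hA, Set.ncard_union_eq hdisj, g_inj.ncard_image]

theorem range_update_of_apply_eq {ι κ : Type*} [DecidableEq ι] (z : ι → κ) {i j : ι}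
    (hji : j ≠ i) (hz : z j = z i) (l : κ) :
    Set.range (Function.update z i l) = insert l (Set.range z) := by
  ext k
  simp only [Set.mem_range, Set.mem_insert_iff, Function.update_apply]
  grind

/-- New-cluster-creation step of RDP-means: if the augmented distance of point `i` to every
existing cluster exceeds `λ`, and `i` is not alone in its cluster, then moving `i` to a fresh
label `ℓ` with center `xᵢ` strictly decreases the constrained clustering objective. -/
theorem rdpMeans_newCluster_decreases_objective {p n : ℕ} (hn : 1 ≤ n)
    (x : Fin n → EuclideanSpace ℝ (Fin p))
    (φ : EuclideanSpace ℝ (Fin p) → ℝ) (hφ : Differentiable ℝ φ)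
    (ξ₁ ξ₂ : ℝ) (hξ₁ : 0 ≤ ξ₁) (hξ₂ : 0 ≤ ξ₂) (lam : ℝ)
    (e : Fin n → Fin n → ℝ)
    (hsym : ∀ i j, e i j = e j i) (hdiag : ∀ i, e i i = 0)
    (hvals : ∀ i j, e i j = -1 ∨ e i j = 0 ∨ e i j = 1)
    (J : (Fin n → ℕ) → (ℕ → EuclideanSpace ℝ (Fin p)) → ℝ)
    (hJ : ∀ (z : Fin n → ℕ) (μ : ℕ → EuclideanSpace ℝ (Fin p)),
      J z μ = (∑ i, bregman φ (x i) (μ (z i)))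
        - ξ₁ * (Nat.card {pr : Fin n × Fin n //
            pr.1 < pr.2 ∧ z pr.1 = z pr.2 ∧ e pr.1 pr.2 = 1} : ℝ)
        + ξ₂ * (Nat.card {pr : Fin n × Fin n //
            pr.1 < pr.2 ∧ z pr.1 = z pr.2 ∧ e pr.1 pr.2 = -1} : ℝ)
        + lam * (Nat.card (Set.range z) : ℝ))
    (z : Fin n → ℕ) (μ : ℕ → EuclideanSpace ℝ (Fin p)) (i : Fin n)
    (f s : ℕ → ℝ)
    (hf : ∀ k, f k = (Nat.card {j : Fin n // j ≠ i ∧ z j = k ∧ e i j = 1} : ℝ))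
    (hs : ∀ k, s k = (Nat.card {j : Fin n // j ≠ i ∧ z j = k ∧ e i j = -1} : ℝ))
    (hbig : ∀ k ∈ Set.range z, lam < bregman φ (x i) (μ k) - ξ₁ * f k + ξ₂ * s k)
    (hnotalone : ∃ j : Fin n, j ≠ i ∧ z j = z i)
    (ℓ : ℕ) (hℓ : ℓ ∉ Set.range z) :
    J (Function.update z i ℓ) (Function.update μ ℓ (x i)) < J z μ := by
  have hne : ∀ a, z a ≠ ℓ := fun a h => hℓ ⟨a, h⟩
  have hcard (c : ℝ) := card_monochromatic_pairs_eq_update_add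
    (r := fun a b => e a b = c) (fun a b h => (hsym b a).trans h) z i hℓ
  have hrange : Nat.card (Set.range (Function.update z i ℓ)) = Nat.card (Set.range z) + 1 := by
    obtain ⟨j, hji, hz⟩ := hnotalone
    rw [range_update_of_apply_eq z hji hz]
    exact Set.ncard_insert_of_notMem hℓ
  have hsum : ∑ a, bregman φ (x a) (μ (z a)) =
      ∑ a, bregman φ (x a) (Function.update μ ℓ (x i) (Function.update z i ℓ a)) +
        bregman φ (x i) (μ (z i)) := by
    rw [← sub_eq_iff_eq_add', ← Finset.sum_sub_distrib, Fintype.sum_eq_single i]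
    · simp
    · intro a ha
      simp [ha, hne a]
  have hlt := hbig (z i) ⟨i, rfl⟩
  rw [hf, hs] at hlt
  rw [hJ, hJ, hsum, hcard 1, hcard (-1), hrange]
  push_cast
  linarith
end
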